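/- Let k be a field, n ≥ 3 an integer, and c : S₃ → k a function such that for every a ∈ {1,2,3} there exists a permutation σ with σ(1) = a and c(σ) ≠ 0. Let A be the quotient of the free associative unital k-algebra on x₁,…,xₙ by the two-sided ideal generated by r_i = Σ_{σ∈S₃} c(σ)·x_{i−1+σ(1)} x_{i−1+σ(2)} x_{i−1+σ(3)}, i = 1,…,n−2, and set p_{ij} = Σ_{σ∈S₃, i−1+σ(1)=j} c(σ)·x_{i−1+σ(2)} x_{i−1+σ(3)}, so that r_i = Σ_j x_j p_{ij}. If elements b₁,…,b_{n−2} ∈ A satisfy Σ_{i=1}^{n−2} p̄_{ij} b_i = 0 in A for every j = 1,…,n, then b₁ = … = b_{n−2} = 0. -/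

import Mathlib

open scoped BigOperators

noncomputable section

universe u

/-- The generator index `i + t` (0-based): for the `i`-th relation (`i = 0,…,n-3`),
the letters involved are `x_i, x_{i+1}, x_{i+2}` (which, 1-based, are the letters
`x_{i'-1+1}, x_{i'-1+2}, x_{i'-1+3}` of the `i'`-th relation, `i' = 1,…,n-2`). -/
def genIdx (n : ℕ) (i : Fin (n - 2)) (t : Fin 3) : Fin n :=
  ⟨i.val + t.val, by have hi := i.isLt; have ht := t.isLt; omega⟩

/-- The cubic relation `r_i = Σ_{σ ∈ S₃} c(σ) · x_{i-1+σ(1)} x_{i-1+σ(2)} x_{i-1+σ(3)}`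
(written 0-based) in the free associative unital algebra `F = k⟨x_1,…,x_n⟩`. -/
def rel (k : Type) [Field k] (n : ℕ) (c : Equiv.Perm (Fin 3) → k) (i : Fin (n - 2)) :
    FreeAlgebra k (Fin n) :=
  ∑ σ : Equiv.Perm (Fin 3),
    c σ • (FreeAlgebra.ι k (genIdx n i (σ 0)) * FreeAlgebra.ι k (genIdx n i (σ 1)) *
      FreeAlgebra.ι k (genIdx n i (σ 2)))

/-- The relation identifying each `r_i` with `0`; quotienting the free algebra by (the ring
congruence generated by) this relation is exactly quotienting by the two-sided ideal
generated by `r_1,…,r_{n-2}`. -/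
def relRel (k : Type) [Field k] (n : ℕ) (c : Equiv.Perm (Fin 3) → k)
    (a b : FreeAlgebra k (Fin n)) : Prop :=
  b = 0 ∧ ∃ i : Fin (n - 2), a = rel k n c i

/-- The algebra `A = k⟨x_1,…,x_n⟩ / (r_1,…,r_{n-2})`. -/
abbrev QuotAlg (k : Type) [Field k] (n : ℕ) (c : Equiv.Perm (Fin 3) → k) : Type :=
  RingQuot (relRel k n c)

/-- The image `x̄_j` of the generator `x_j` in `A`. -/
def Xbar (k : Type) [Field k] (n : ℕ) (c : Equiv.Perm (Fin 3) → k) (j : Fin n) :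
    QuotAlg k n c :=
  RingQuot.mkAlgHom k (relRel k n c) (FreeAlgebra.ι k j)

/-- The element `p_{ij} = Σ_{σ ∈ S₃, i-1+σ(1) = j} c(σ) · x_{i-1+σ(2)} x_{i-1+σ(3)}` of the
free algebra (0-based), so that `r_i = Σ_j x_j p_{ij}`. -/
def pGen (k : Type) [Field k] (n : ℕ) (c : Equiv.Perm (Fin 3) → k) (i : Fin (n - 2))
    (j : Fin n) : FreeAlgebra k (Fin n) :=
  ∑ σ ∈ Finset.univ.filter (fun σ : Equiv.Perm (Fin 3) => genIdx n i (σ 0) = j),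
    c σ • (FreeAlgebra.ι k (genIdx n i (σ 1)) * FreeAlgebra.ι k (genIdx n i (σ 2)))

/-- The image `p̄_{ij}` of `p_{ij}` in `A`. -/
def Pbar (k : Type) [Field k] (n : ℕ) (c : Equiv.Perm (Fin 3) → k) (i : Fin (n - 2))
    (j : Fin n) : QuotAlg k n c :=
  RingQuot.mkAlgHom k (relRel k n c) (pGen k n c i j)

/-- The augmentation `ε : A → k`, the unique `k`-algebra map sending every `x̄_j` to `0`. -/
def aug (k : Type) [Field k] (n : ℕ) (c : Equiv.Perm (Fin 3) → k) :
    QuotAlg k n c →ₐ[k] k :=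
  RingQuot.liftAlgHom k ⟨FreeAlgebra.lift k (fun _ => (0 : k)), by
    rintro a b ⟨rfl, i, rfl⟩
    simp [rel, FreeAlgebra.lift_ι_apply]⟩

/-- The `A`-module `M` has projective dimension at most 2: there is an exact sequence
`0 → P₂ → P₁ → P₀ → M → 0` with all `Pᵢ` projective. -/
def HasProjDimLE2 (A : Type) [Ring A] (M : Type u) [AddCommGroup M] [Module A M] : Prop :=
  ∃ P₂ P₁ P₀ : ModuleCat.{u} A,
    Module.Projective A P₂ ∧ Module.Projective A P₁ ∧ Module.Projective A P₀ ∧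
    ∃ (f₂ : P₂ →ₗ[A] P₁) (f₁ : P₁ →ₗ[A] P₀) (f₀ : P₀ →ₗ[A] M),
      Function.Injective f₂ ∧
      LinearMap.range f₂ = LinearMap.ker f₁ ∧
      LinearMap.range f₁ = LinearMap.ker f₀ ∧
      Function.Surjective f₀

/-- The `A`-module `M` has projective dimension at most 1: there is an exact sequence
`0 → P₁ → P₀ → M → 0` with `P₀, P₁` projective. -/
def HasProjDimLE1 (A : Type) [Ring A] (M : Type u) [AddCommGroup M] [Module A M] : Prop :=
  ∃ P₁ P₀ : ModuleCat.{u} A,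
    Module.Projective A P₁ ∧ Module.Projective A P₀ ∧
    ∃ (f₁ : P₁ →ₗ[A] P₀) (f₀ : P₀ →ₗ[A] M),
      Function.Injective f₁ ∧
      LinearMap.range f₁ = LinearMap.ker f₀ ∧
      Function.Surjective f₀

/-- The position in `{0,1,2}` of the unique letter of the `i`-th relation whose index is
divisible by `3`. -/
def pivotPos {n : ℕ} (i : Fin (n - 2)) : Fin 3 :=
  ⟨(2 * i.val) % 3, Nat.mod_lt _ (by norm_num)⟩

theorem genIdx_mod_three_eq_zero_iff {n : ℕ} (i : Fin (n - 2)) (t : Fin 3) :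
    (genIdx n i t).val % 3 = 0 ↔ t = pivotPos i := by
  simp only [genIdx, pivotPos, Fin.ext_iff]
  omega

theorem genIdx_injective {n : ℕ} (i : Fin (n - 2)) : Function.Injective (genIdx n i) := by
  intro s t h
  simpa [genIdx, Fin.ext_iff] using h

/-- A relation and a permutation are determined by the corresponding cubic monomial. -/
theorem eq_of_genIdx_eq {n : ℕ} {i j : Fin (n - 2)} {σ τ : Equiv.Perm (Fin 3)}
    (h : ∀ t, genIdx n i (σ t) = genIdx n j (τ t)) : i = j ∧ σ = τ := by
  have hsum : ∑ t, (i.val + (σ t).val) = ∑ t, (j.val + (τ t).val) :=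
    Finset.sum_congr rfl fun t _ => congrArg Fin.val (h t)
  have hσ := Equiv.sum_comp σ (fun t : Fin 3 => t.val)
  have hτ := Equiv.sum_comp τ (fun t : Fin 3 => t.val)
  simp only [Finset.sum_add_distrib, hσ, hτ] at hsum
  simp only [Finset.sum_const, Finset.card_univ, Fintype.card_fin, smul_eq_mul] at hsum
  obtain rfl : i = j := Fin.ext (by omega)
  exact ⟨rfl, Equiv.ext fun t => genIdx_injective i (h t)⟩

/-- Prepending the letter `x` to words, extended linearly to the free module on words. -/
def consMap (k : Type) [Field k] {n : ℕ} (x : Fin n) :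
    (List (Fin n) →₀ k) →ₗ[k] (List (Fin n) →₀ k) :=
  Finsupp.lmapDomain k k (List.cons x)

@[simp]
theorem consMap_single {k : Type} [Field k] {n : ℕ} (x : Fin n) (v : List (Fin n)) (r : k) :
    consMap k x (Finsupp.single v r) = Finsupp.single (x :: v) r := by
  simp [consMap]

theorem consMap_apply_cons {k : Type} [Field k] {n : ℕ} (x y : Fin n) (f : List (Fin n) →₀ k)
    (u : List (Fin n)) : consMap k x f (y :: u) = if x = y then f u else 0 := by
  split_ifs with h
  · subst h
    exact Finsupp.mapDomain_apply List.cons_injective f u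
  · refine Finsupp.mapDomain_of_notMem_range f _ ?_
    rintro ⟨v, hv⟩
    exact h (List.cons.inj hv).1

section WordAction

variable {k : Type} [Field k] {n : ℕ} (c : Equiv.Perm (Fin 3) → k)
  (s : Fin 3 → Equiv.Perm (Fin 3))

/-- `z a b` is the leading monomial of the `i`-th relation, for the choice `s` of a permutation
for every position of the pivot letter. -/
def IsLead (i : Fin (n - 2)) (z a b : Fin n) : Prop :=
  z = genIdx n i (s (pivotPos i) 0) ∧ a = genIdx n i (s (pivotPos i) 1) ∧
    b = genIdx n i (s (pivotPos i) 2)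

open Classical in
/-- The action of the letter `z` on a word: prepend `z`, and if this creates a leading monomial
`z a b` at the front, rewrite it by means of the corresponding relation. -/
def wordAct (z : Fin n) : List (Fin n) → (List (Fin n) →₀ k)
  | [] => Finsupp.single [z] 1
  | [a] => Finsupp.single [z, a] 1
  | a :: b :: u =>
    if h : ∃ i, IsLead s i z a b then
      -(c (s (pivotPos h.choose)))⁻¹ • ∑ σ ∈ Finset.univ.erase (s (pivotPos h.choose)),
        c σ • (if σ 0 = pivotPos h.choose then
            Finsupp.single (z :: genIdx n h.choose (σ 1) :: genIdx n h.choose (σ 2) :: u) 1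
          else if σ 1 = pivotPos h.choose then
            consMap k (genIdx n h.choose (σ 0)) (wordAct z (genIdx n h.choose (σ 2) :: u))
          else consMap k (genIdx n h.choose (σ 0))
            (consMap k (genIdx n h.choose (σ 1)) (wordAct z u)))
    else Finsupp.single (z :: a :: b :: u) 1
termination_by v => v.length

/-- The linear extension of `wordAct` to the free module on words. -/
def letterAct (z : Fin n) : Module.End k (List (Fin n) →₀ k) :=
  Finsupp.linearCombination k (wordAct c s z)

@[simp]
theorem letterAct_single_one (z : Fin n) (v : List (Fin n)) :
    letterAct c s z (Finsupp.single v 1) = wordAct c s z v := by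
  simp [letterAct]

variable {s}

theorem IsLead.eq {i j : Fin (n - 2)} {σ : Equiv.Perm (Fin 3)}
    (h : IsLead s j (genIdx n i (σ 0)) (genIdx n i (σ 1)) (genIdx n i (σ 2))) :
    i = j ∧ σ = s (pivotPos j) := by
  refine eq_of_genIdx_eq fun t => ?_
  fin_cases t
  exacts [h.1, h.2.1, h.2.2]

theorem wordAct_of_not_isLead {z a b : Fin n} (h : ∀ i, ¬ IsLead s i z a b)
    (u : List (Fin n)) :
    wordAct c s z (a :: b :: u) = Finsupp.single (z :: a :: b :: u) 1 := by
  rw [wordAct, dif_neg (not_exists.2 h)]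

theorem wordAct_of_isLead {i : Fin (n - 2)} {z a b : Fin n} (h : IsLead s i z a b)
    (u : List (Fin n)) :
    wordAct c s z (a :: b :: u) =
      -(c (s (pivotPos i)))⁻¹ • ∑ σ ∈ Finset.univ.erase (s (pivotPos i)),
        c σ • (if σ 0 = pivotPos i then
            Finsupp.single (z :: genIdx n i (σ 1) :: genIdx n i (σ 2) :: u) 1
          else if σ 1 = pivotPos i then
            consMap k (genIdx n i (σ 0)) (wordAct c s z (genIdx n i (σ 2) :: u))
          else consMap k (genIdx n i (σ 0))
            (consMap k (genIdx n i (σ 1)) (wordAct c s z u))) := by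
  have hex : ∃ i, IsLead s i z a b := ⟨i, h⟩
  have hi : hex.choose = i := by
    have h' := hex.choose_spec
    obtain ⟨rfl, rfl, rfl⟩ := h
    exact h'.eq.1.symm
  rw [wordAct, dif_pos hex, hi]

theorem IsLead.eq_genIdx_pivotPos (hs : ∀ a, s a 0 = a) {i : Fin (n - 2)}
    {z a b : Fin n} (h : IsLead s i z a b) :
    z = genIdx n i (pivotPos i) := by
  rw [h.1, hs]

theorem letterAct_eq_consMap (hs : ∀ a, s a 0 = a) {z : Fin n} (hz : z.val % 3 ≠ 0) :
    letterAct c s z = consMap k z := by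
  refine Finsupp.lhom_ext' fun v => LinearMap.ext_ring ?_
  suffices h : wordAct c s z v = Finsupp.single (z :: v) 1 by simpa using h
  match v with
  | [] => rw [wordAct]
  | [a] => rw [wordAct]
  | a :: b :: u =>
    refine wordAct_of_not_isLead c (fun i h => hz ?_) u
    rw [h.eq_genIdx_pivotPos hs, genIdx_mod_three_eq_zero_iff]

theorem letterAct_genIdx (hs : ∀ a, s a 0 = a) {i : Fin (n - 2)} {t : Fin 3} (ht : t ≠ pivotPos i) :
    letterAct c s (genIdx n i t) = consMap k (genIdx n i t) :=
  letterAct_eq_consMap c hs fun h => ht ((genIdx_mod_three_eq_zero_iff i t).1 h)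

/-- Every relation acts as zero on the free module on words. -/
theorem sum_letterAct_eq_zero (hs : ∀ a, s a 0 = a) (hcs : ∀ a, c (s a) ≠ 0) (i : Fin (n - 2)) :
    ∑ σ : Equiv.Perm (Fin 3), c σ • (letterAct c s (genIdx n i (σ 0)) *
      letterAct c s (genIdx n i (σ 1)) * letterAct c s (genIdx n i (σ 2))) = 0 := by
  refine Finsupp.lhom_ext' fun u => LinearMap.ext_ring ?_
  simp only [LinearMap.comp_apply, LinearMap.sum_apply, LinearMap.smul_apply,
    Module.End.mul_apply, Finsupp.lsingle_apply, LinearMap.zero_apply]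
  have hne {σ : Equiv.Perm (Fin 3)} {t t' : Fin 3} (h : σ t = pivotPos i) (htt : t' ≠ t) :
      σ t' ≠ pivotPos i := fun h' => htt (σ.injective (h'.trans h.symm))
  have hlead : IsLead s i (genIdx n i (s (pivotPos i) 0)) (genIdx n i (s (pivotPos i) 1))
      (genIdx n i (s (pivotPos i) 2)) := ⟨rfl, rfl, rfl⟩
  have h0 : s (pivotPos i) 0 = pivotPos i := hs _
  rw [← Finset.add_sum_erase _ _ (Finset.mem_univ (s (pivotPos i))),
    letterAct_genIdx c hs (hne h0 (t' := 1) (by decide)),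
    letterAct_genIdx c hs (hne h0 (t' := 2) (by decide)), consMap_single, consMap_single,
    letterAct_single_one, wordAct_of_isLead c hlead, smul_smul, mul_neg,
    mul_inv_cancel₀ (hcs _), neg_one_smul, neg_add_eq_zero]
  refine Finset.sum_congr rfl fun σ hσ => congrArg (c σ • ·) ?_
  rw [h0]
  split_ifs with hσ0 hσ1
  · rw [letterAct_genIdx c hs (hne hσ0 (t' := 1) (by decide)),
      letterAct_genIdx c hs (hne hσ0 (t' := 2) (by decide)), consMap_single, consMap_single,
      letterAct_single_one, wordAct_of_not_isLead c, hσ0]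
    intro j hj
    obtain ⟨rfl, h⟩ := hj.eq
    exact Finset.ne_of_mem_erase hσ h
  · rw [letterAct_genIdx c hs hσ0, letterAct_genIdx c hs (hne hσ1 (t' := 2) (by decide)),
      consMap_single, letterAct_single_one, hσ1]
  · have hσ2 : σ 2 = pivotPos i := by
      obtain ⟨t, ht⟩ := σ.surjective (pivotPos i)
      fin_cases t
      exacts [absurd ht hσ0, absurd ht hσ1, ht]
    rw [letterAct_genIdx c hs hσ0, letterAct_genIdx c hs hσ1, letterAct_single_one, hσ2]

/-- The action of the quotient algebra on the free module on words. -/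
def quotAct (hs : ∀ a, s a 0 = a) (hcs : ∀ a, c (s a) ≠ 0) :
    QuotAlg k n c →ₐ[k] Module.End k (List (Fin n) →₀ k) :=
  RingQuot.liftAlgHom k ⟨FreeAlgebra.lift k (letterAct c s), by
    rintro a b ⟨rfl, i, rfl⟩
    simpa [rel] using sum_letterAct_eq_zero c hs hcs i⟩

theorem quotAct_mkAlgHom (hs : ∀ a, s a 0 = a) (hcs : ∀ a, c (s a) ≠ 0)
    (x : FreeAlgebra k (Fin n)) :
    quotAct c hs hcs (RingQuot.mkAlgHom k (relRel k n c) x) =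
      FreeAlgebra.lift k (letterAct c s) x := by
  simp [quotAct]

/-- The linear map sending a word to its class in the quotient algebra. -/
def wordClass : (List (Fin n) →₀ k) →ₗ[k] QuotAlg k n c :=
  Finsupp.linearCombination k fun v => (v.map (Xbar k n c)).prod

@[simp]
theorem wordClass_single_one (v : List (Fin n)) :
    wordClass c (Finsupp.single v 1) = (v.map (Xbar k n c)).prod := by
  simp [wordClass]

@[simp]
theorem wordClass_consMap (x : Fin n) (f : List (Fin n) →₀ k) :
    wordClass c (consMap k x f) = Xbar k n c x * wordClass c f := by
  induction f using Finsupp.induction_linear with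
  | zero => simp
  | add f g hf hg => simp [hf, hg, mul_add]
  | single v r => simp [wordClass]

theorem sum_Xbar_eq_zero (i : Fin (n - 2)) :
    ∑ σ : Equiv.Perm (Fin 3), c σ • (Xbar k n c (genIdx n i (σ 0)) *
      Xbar k n c (genIdx n i (σ 1)) * Xbar k n c (genIdx n i (σ 2))) = 0 := by
  have h : RingQuot.mkAlgHom k (relRel k n c) (rel k n c i) =
      RingQuot.mkAlgHom k (relRel k n c) 0 := RingQuot.mkAlgHom_rel k ⟨rfl, i, rfl⟩
  simpa [rel, Xbar] using h

theorem wordClass_wordAct (hs : ∀ a, s a 0 = a) (hcs : ∀ a, c (s a) ≠ 0) (z : Fin n)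
    (v : List (Fin n)) :
    wordClass c (wordAct c s z v) = Xbar k n c z * (v.map (Xbar k n c)).prod := by
  match v with
  | [] => simp [wordAct]
  | [a] => simp [wordAct]
  | a :: b :: u =>
    by_cases h : ∃ i, IsLead s i z a b
    · obtain ⟨i, hi⟩ := h
      have hz := hi.eq_genIdx_pivotPos hs
      have key := sum_Xbar_eq_zero c i
      rw [← Finset.add_sum_erase _ _ (Finset.mem_univ (s (pivotPos i))), ← hi.1, ← hi.2.1,
        ← hi.2.2, add_eq_zero_iff_eq_neg] at key
      have key' : Xbar k n c z * Xbar k n c a * Xbar k n c b =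
          -(c (s (pivotPos i)))⁻¹ • ∑ σ ∈ Finset.univ.erase (s (pivotPos i)),
            c σ • (Xbar k n c (genIdx n i (σ 0)) * Xbar k n c (genIdx n i (σ 1)) *
              Xbar k n c (genIdx n i (σ 2))) := by
        rw [← inv_smul_smul₀ (hcs (pivotPos i)) (Xbar k n c z * Xbar k n c a * Xbar k n c b), key,
          Algebra.smul_def, Algebra.smul_def (-_), map_neg]
        exact (neg_mul_comm (_ : QuotAlg k n c) _).symm
      rw [wordAct_of_isLead c hi, List.map_cons, List.map_cons, List.prod_cons, List.prod_cons,
        ← mul_assoc, ← mul_assoc, key', map_smul, map_sum, smul_mul_assoc, Finset.sum_mul]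
      refine congrArg _ (Finset.sum_congr rfl fun σ _ => ?_)
      rw [map_smul, smul_mul_assoc]
      refine congrArg (c σ • ·) ?_
      split_ifs with hσ0 hσ1
      · simp [hσ0, hz, mul_assoc]
      · rw [wordClass_consMap, wordClass_wordAct hs hcs]
        simp [hσ1, hz, mul_assoc]
      · have hσ2 : σ 2 = pivotPos i := by
          obtain ⟨t, ht⟩ := σ.surjective (pivotPos i)
          fin_cases t
          exacts [absurd ht hσ0, absurd ht hσ1, ht]
        rw [wordClass_consMap, wordClass_consMap, wordClass_wordAct hs hcs]
        simp [hσ2, hz, mul_assoc]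
    · rw [wordAct_of_not_isLead c (not_exists.1 h)]
      simp
termination_by v.length

theorem wordClass_letterAct (hs : ∀ a, s a 0 = a) (hcs : ∀ a, c (s a) ≠ 0) (z : Fin n)
    (f : List (Fin n) →₀ k) :
    wordClass c (letterAct c s z f) = Xbar k n c z * wordClass c f := by
  induction f using Finsupp.induction_linear with
  | zero => simp
  | add f g hf hg => simp [hf, hg, mul_add]
  | single v r =>
    rw [← mul_one r, ← smul_eq_mul, ← Finsupp.smul_single, map_smul, map_smul, map_smul,
      letterAct_single_one, wordClass_wordAct c hs hcs, wordClass_single_one, mul_smul_comm]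

theorem wordClass_quotAct (hs : ∀ a, s a 0 = a) (hcs : ∀ a, c (s a) ≠ 0) (a : QuotAlg k n c)
    (f : List (Fin n) →₀ k) :
    wordClass c (quotAct c hs hcs a f) = a * wordClass c f := by
  obtain ⟨x, rfl⟩ := RingQuot.mkAlgHom_surjective k (relRel k n c) a
  rw [quotAct_mkAlgHom]
  induction x using FreeAlgebra.induction generalizing f with
  | grade0 r => simp [Algebra.smul_def]
  | grade1 x => simpa [Xbar] using wordClass_letterAct c hs hcs x f
  | mul x y hx hy => simp [hx, hy, mul_assoc]
  | add x y hx hy => simp [hx, hy, add_mul]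

theorem quotAct_Pbar (hs : ∀ a, s a 0 = a) (hcs : ∀ a, c (s a) ≠ 0) (i : Fin (n - 2)) {j : Fin n}
    (hj : j.val % 3 = 0) (f : List (Fin n) →₀ k) :
    quotAct c hs hcs (Pbar k n c i j) f =
      ∑ σ ∈ Finset.univ.filter (fun σ : Equiv.Perm (Fin 3) => genIdx n i (σ 0) = j),
        c σ • consMap k (genIdx n i (σ 1)) (consMap k (genIdx n i (σ 2)) f) := by
  simp only [Pbar, quotAct_mkAlgHom, pGen, map_sum, map_smul, map_mul, FreeAlgebra.lift_ι_apply,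
    LinearMap.sum_apply, LinearMap.smul_apply, Module.End.mul_apply]
  refine Finset.sum_congr rfl fun σ hσ => congrArg (c σ • ·) ?_
  have hσ0 : σ 0 = pivotPos i := by
    rw [← genIdx_mod_three_eq_zero_iff, (Finset.mem_filter.1 hσ).2, hj]
  rw [letterAct_genIdx c hs, letterAct_genIdx c hs] <;>
    exact fun h => absurd (σ.injective (h.trans hσ0.symm)) (by decide)

end WordAction

/-- if `b₁,…,b_{n-2} ∈ A` satisfy `Σ_i p̄_{ij} b_i = 0` for every `j`, then all
`b_i` vanish. -/
theorem pbar_relations_independent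
    (k : Type) [Field k] (n : ℕ) (hn : 3 ≤ n)
    (c : Equiv.Perm (Fin 3) → k)
    (hc : ∀ a : Fin 3, ∃ σ : Equiv.Perm (Fin 3), σ 0 = a ∧ c σ ≠ 0)
    (b : Fin (n - 2) → QuotAlg k n c)
    (hb : ∀ j : Fin n, (∑ i, Pbar k n c i j * b i) = 0) :
    ∀ i, b i = 0 := by
  choose s hs hcs using hc
  let v (i : Fin (n - 2)) : List (Fin n) →₀ k := quotAct c hs hcs (b i) (Finsupp.single [] 1)
  suffices hv : ∀ i, v i = 0 by
    intro i
    have h := wordClass_quotAct c hs hcs (b i) (Finsupp.single [] 1)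
    rw [show quotAct c hs hcs (b i) (Finsupp.single [] 1) = 0 from hv i] at h
    simpa using h.symm
  intro i
  have hj : (genIdx n i (s (pivotPos i) 0)).val % 3 = 0 := by
    rw [genIdx_mod_three_eq_zero_iff, hs]
  have h := congrArg (fun a => quotAct c hs hcs a (Finsupp.single [] 1))
    (hb (genIdx n i (s (pivotPos i) 0)))
  simp only [map_sum, map_mul, LinearMap.sum_apply, Module.End.mul_apply, map_zero,
    LinearMap.zero_apply, quotAct_Pbar c hs hcs _ hj] at h
  ext u
  have hu := DFunLike.congr_fun h
    (genIdx n i (s (pivotPos i) 1) :: genIdx n i (s (pivotPos i) 2) :: u)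
  simp only [Finsupp.finsetSum_apply, Finsupp.smul_apply, consMap_apply_cons,
    Finsupp.zero_apply] at hu
  rw [Finset.sum_eq_single i, Finset.sum_eq_single (s (pivotPos i))] at hu
  · simpa [hcs] using hu
  · intro σ hσ hne
    rw [← ite_and, if_neg, smul_zero]
    rintro ⟨h1, h2⟩
    refine hne (IsLead.eq (s := s) (i := i) (j := i) ⟨?_, h1, h2⟩).2
    exact (Finset.mem_filter.1 hσ).2
  · simp
  · intro j _ hne
    refine Finset.sum_eq_zero fun σ hσ => ?_
    rw [← ite_and, if_neg, smul_zero]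
    rintro ⟨h1, h2⟩
    exact hne (IsLead.eq (s := s) (j := i) ⟨(Finset.mem_filter.1 hσ).2, h1, h2⟩).1
  · simp

end
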